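/- For p ≥ 1 and probability measures P, Q on ℝ with finite p-th moments, W_p(P,Q) = (∫_0^1 |C_P^{-1}(r) − C_Q^{-1}(r)|^p dr)^{1/p}, where C_P^{-1} is the generalized quantile function of P. -/

import Mathlib

open MeasureTheory ProbabilityTheory ENNReal

/-- The set of couplings of two measures. -/
def coupling {X : Type*} [MeasurableSpace X] (P Q : Measure X) : Set (Measure (X × X)) :=
  {γ | γ.map Prod.fst = P ∧ γ.map Prod.snd = Q}

/-- The `p`-Wasserstein distance. -/
noncomputable def Wp {X : Type*} [MeasurableSpace X] [EDist X] (p : ℝ)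
    (P Q : Measure X) : ℝ≥0∞ :=
  (⨅ γ ∈ coupling P Q, ∫⁻ z, edist z.1 z.2 ^ p ∂γ) ^ (1 / p)

/-- The generalized quantile function of a probability measure on `ℝ`. -/
noncomputable def quantile (P : Measure ℝ) (r : ℝ) : ℝ :=
  sInf {x : ℝ | r ≤ cdf P x}

open Set

/-- The quantile function is the lower adjoint of the cdf. -/
lemma quantile_le_iff (P : Measure ℝ) {r : ℝ} (hr : r ∈ Ioo (0 : ℝ) 1) (x : ℝ) :
    quantile P r ≤ x ↔ r ≤ cdf P x := by
  have hbdd : BddBelow {x : ℝ | r ≤ cdf P x} := by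
    obtain ⟨a, ha⟩ := ((tendsto_cdf_atBot P).eventually_lt_const hr.1).exists
    exact ⟨a, fun y hy => le_of_not_gt fun hlt =>
      absurd (hy.trans (monotone_cdf P hlt.le)) ha.not_ge⟩
  have hne : {x : ℝ | r ≤ cdf P x}.Nonempty :=
    (((tendsto_cdf_atTop P).eventually_const_lt hr.2).exists).imp fun _ h => h.le
  refine ⟨fun h => ?_, fun h => csInf_le hbdd h⟩
  refine ge_of_tendsto
    (((cdf P).right_continuous x).tendsto.mono_left (nhdsWithin_mono x Ioi_subset_Ici_self)) ?_
  filter_upwards [self_mem_nhdsWithin] with y hy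
  obtain ⟨z, hz, hzy⟩ := exists_lt_of_csInf_lt hne (h.trans_lt hy)
  exact le_trans hz (monotone_cdf P hzy.le)

lemma aemeasurable_quantile (P : Measure ℝ) :
    AEMeasurable (quantile P) (volume.restrict (Ioo (0 : ℝ) 1)) := by
  refine aemeasurable_restrict_of_monotoneOn measurableSet_Ioo fun r hr s hs hrs => ?_
  rw [quantile_le_iff P hr]
  exact hrs.trans ((quantile_le_iff P hs _).1 le_rfl)

/-- The quantile function pushes the uniform law on `(0, 1)` forward to `P`. -/
lemma map_quantile (P : Measure ℝ) [IsProbabilityMeasure P] :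
    (volume.restrict (Ioo (0 : ℝ) 1)).map (quantile P) = P := by
  refine Measure.ext_of_Iic _ _ fun a => ?_
  rw [Measure.map_apply_of_aemeasurable (aemeasurable_quantile P) measurableSet_Iic,
    Measure.restrict_apply' measurableSet_Ioo, ← ofReal_cdf]
  have hset : quantile P ⁻¹' Iic a ∩ Ioo 0 1 = Iic (cdf P a) ∩ Ioo 0 1 := by
    ext r
    simp only [mem_inter_iff, mem_preimage, mem_Iic, and_congr_left_iff]
    exact fun hr => quantile_le_iff P hr a
  rw [hset, ← Measure.restrict_apply' measurableSet_Ioo,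
    Measure.restrict_congr_set Ioo_ae_eq_Ioc, Measure.restrict_apply' measurableSet_Ioc,
    inter_comm, Ioc_inter_Iic, inf_eq_right.2 (cdf_le_one P a), Real.volume_Ioc, sub_zero]

/-- The comonotone coupling: the joint law of the quantile functions of `P` and `Q`. -/
noncomputable def quantileCoupling (P Q : Measure ℝ) : Measure (ℝ × ℝ) :=
  (volume.restrict (Ioo (0 : ℝ) 1)).map fun r => (quantile P r, quantile Q r)

lemma aemeasurable_quantile_prodMk (P Q : Measure ℝ) :
    AEMeasurable (fun r => (quantile P r, quantile Q r)) (volume.restrict (Ioo (0 : ℝ) 1)) :=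
  (aemeasurable_quantile P).prodMk (aemeasurable_quantile Q)

lemma quantileCoupling_mem_coupling (P Q : Measure ℝ) [IsProbabilityMeasure P]
    [IsProbabilityMeasure Q] : quantileCoupling P Q ∈ coupling P Q := by
  constructor
  · rw [quantileCoupling, AEMeasurable.map_map_of_aemeasurable measurable_fst.aemeasurable
      (aemeasurable_quantile_prodMk P Q)]
    exact map_quantile P
  · rw [quantileCoupling, AEMeasurable.map_map_of_aemeasurable measurable_snd.aemeasurable
      (aemeasurable_quantile_prodMk P Q)]
    exact map_quantile Q

lemma map_swap_quantileCoupling (P Q : Measure ℝ) :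
    (quantileCoupling P Q).map Prod.swap = quantileCoupling Q P := by
  rw [quantileCoupling, AEMeasurable.map_map_of_aemeasurable measurable_swap.aemeasurable
    (aemeasurable_quantile_prodMk P Q)]
  rfl

lemma map_swap_mem_coupling {X : Type*} [MeasurableSpace X] {P Q : Measure X}
    {γ : Measure (X × X)} (hγ : γ ∈ coupling P Q) : γ.map Prod.swap ∈ coupling Q P := by
  constructor
  · rw [Measure.map_map measurable_fst measurable_swap]
    exact hγ.2
  · rw [Measure.map_map measurable_snd measurable_swap]
    exact hγ.1

lemma isProbabilityMeasure_of_mem_coupling {X : Type*} [MeasurableSpace X] {P Q : Measure X}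
    [IsProbabilityMeasure P] {γ : Measure (X × X)} (hγ : γ ∈ coupling P Q) :
    IsProbabilityMeasure γ := by
  have : IsProbabilityMeasure (γ.map Prod.fst) := by rw [hγ.1]; infer_instance
  exact Measure.isProbabilityMeasure_of_map Prod.fst

/-- Among all couplings, the comonotone one minimizes the mass of each lower right quadrant. -/
lemma quantileCoupling_Ioi_prod_Iic_le {P Q : Measure ℝ} [IsProbabilityMeasure P]
    [IsProbabilityMeasure Q] {γ : Measure (ℝ × ℝ)} (hγ : γ ∈ coupling P Q) (a b : ℝ) :
    quantileCoupling P Q (Ioi a ×ˢ Iic b) ≤ γ (Ioi a ×ˢ Iic b) := by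
  have := isProbabilityMeasure_of_mem_coupling hγ
  have hupper : quantileCoupling P Q (Ioi a ×ˢ Iic b) ≤ Q (Iic b) - P (Iic a) := by
    rw [quantileCoupling, Measure.map_apply_of_aemeasurable (aemeasurable_quantile_prodMk P Q)
      (measurableSet_Ioi.prod measurableSet_Iic), Measure.restrict_apply' measurableSet_Ioo,
      ← ofReal_cdf, ← ofReal_cdf, ← ENNReal.ofReal_sub _ (cdf_nonneg P a), ← Real.volume_Ioc]
    refine measure_mono fun r ⟨⟨h₁, h₂⟩, hr⟩ => ⟨?_, (quantile_le_iff Q hr b).1 h₂⟩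
    exact lt_of_not_ge fun h => absurd ((quantile_le_iff P hr a).2 h) (not_le.2 h₁)
  have hP : P (Iic a) = γ (Prod.fst ⁻¹' Iic a) := by
    rw [← hγ.1, Measure.map_apply measurable_fst measurableSet_Iic]
  have hQ : Q (Iic b) = γ (Prod.snd ⁻¹' Iic b) := by
    rw [← hγ.2, Measure.map_apply measurable_snd measurableSet_Iic]
  refine hupper.trans ?_
  rw [hP, hQ]
  refine le_measure_sdiff.trans (measure_mono fun z hz => ⟨?_, hz.1⟩)
  exact lt_of_not_ge fun h : z.1 ≤ a => hz.2 h

lemma lintegral_ofReal_sub_sub (γ : Measure (ℝ × ℝ)) [SFinite γ] (u : ℝ) :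
    ∫⁻ z, ENNReal.ofReal (z.1 - z.2 - u) ∂γ = ∫⁻ t, γ (Ioi t ×ˢ Iic (t - u)) := by
  have hs : MeasurableSet {w : (ℝ × ℝ) × ℝ | w.1.2 + u ≤ w.2 ∧ w.2 < w.1.1} := by
    have h₁ : MeasurableSet {w : (ℝ × ℝ) × ℝ | w.1.2 + u ≤ w.2} :=
      measurableSet_le (by fun_prop) (by fun_prop)
    have h₂ : MeasurableSet {w : (ℝ × ℝ) × ℝ | w.2 < w.1.1} :=
      measurableSet_lt (by fun_prop) (by fun_prop)
    exact h₁.inter h₂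
  have h := (Measure.prod_apply (μ := γ) (ν := (volume : Measure ℝ)) hs).symm.trans
    (Measure.prod_apply_symm hs)
  convert h using 3 with z t
  · rw [sub_sub, ← Real.volume_Ico]
    rfl
  · congr 1
    ext z
    simp [le_sub_iff_add_le, and_comm]

lemma lintegral_quantileCoupling_ofReal_sub_sub_le {P Q : Measure ℝ} [IsProbabilityMeasure P]
    [IsProbabilityMeasure Q] {γ : Measure (ℝ × ℝ)} (hγ : γ ∈ coupling P Q) (u : ℝ) :
    ∫⁻ z, ENNReal.ofReal (z.1 - z.2 - u) ∂quantileCoupling P Q ≤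
      ∫⁻ z, ENNReal.ofReal (z.1 - z.2 - u) ∂γ := by
  have := isProbabilityMeasure_of_mem_coupling hγ
  have := isProbabilityMeasure_of_mem_coupling (quantileCoupling_mem_coupling P Q)
  rw [lintegral_ofReal_sub_sub, lintegral_ofReal_sub_sub]
  exact lintegral_mono fun t => quantileCoupling_Ioi_prod_Iic_le hγ _ _

/-- For `p > 1`, the positive part of `d ^ p` is a mixture of the functions `d ↦ (d - u)⁺`. -/
lemma ofReal_rpow_eq_lintegral {p : ℝ} (hp : 1 < p) (d : ℝ) :
    ENNReal.ofReal d ^ p =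
      ∫⁻ u in Ioi (0 : ℝ), ENNReal.ofReal (p * (p - 1) * u ^ (p - 2)) *
        ENNReal.ofReal (d - u) := by
  rcases le_or_gt d 0 with hd | hd
  · rw [ENNReal.ofReal_of_nonpos hd, ENNReal.zero_rpow_of_pos (by linarith), eq_comm,
      setLIntegral_congr_fun (g := fun _ => 0) measurableSet_Ioi, lintegral_zero]
    intro u hu
    have : d - u ≤ 0 := by linarith [mem_Ioi.1 hu]
    simp [ENNReal.ofReal_of_nonpos this]
  have hrestrict : ∫⁻ u in Ioi (0 : ℝ), ENNReal.ofReal (p * (p - 1) * u ^ (p - 2)) *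
      ENNReal.ofReal (d - u) = ∫⁻ u in Ioc (0 : ℝ) d,
        ENNReal.ofReal (p * (p - 1) * (d * u ^ (p - 2) - u ^ (p - 1))) := by
    rw [← lintegral_indicator measurableSet_Ioi, ← lintegral_indicator measurableSet_Ioc]
    congr 1 with u
    by_cases hu : 0 < u
    · by_cases hud : u ≤ d
      · rw [indicator_of_mem (mem_Ioi.2 hu), indicator_of_mem (mem_Ioc.2 ⟨hu, hud⟩),
          ← ENNReal.ofReal_mul' (by linarith), show p - 1 = p - 2 + 1 by ring,
          Real.rpow_add_one hu.ne']
        congr 1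
        ring
      · rw [indicator_of_mem (mem_Ioi.2 hu), indicator_of_notMem fun h => hud h.2,
          ENNReal.ofReal_of_nonpos (p := d - u) (by linarith), mul_zero]
    · rw [indicator_of_notMem (by simpa using hu), indicator_of_notMem fun h => hu h.1]
  have hint₁ : IntervalIntegrable (fun u : ℝ => d * u ^ (p - 2)) volume 0 d :=
    (intervalIntegral.intervalIntegrable_rpow' (by linarith)).const_mul d
  have hint₂ : IntervalIntegrable (fun u : ℝ => u ^ (p - 1)) volume 0 d :=
    intervalIntegral.intervalIntegrable_rpow' (by linarith)
  have hint := (hint₁.sub hint₂).const_mul (p * (p - 1))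
  rw [hrestrict, ← ofReal_integral_eq_lintegral_ofReal
    ((intervalIntegrable_iff_integrableOn_Ioc_of_le hd.le).1 hint),
    ← intervalIntegral.integral_of_le hd.le, intervalIntegral.integral_const_mul,
    intervalIntegral.integral_sub hint₁ hint₂, intervalIntegral.integral_const_mul,
    integral_rpow (Or.inl (by linarith)), integral_rpow (Or.inl (by linarith)),
    ENNReal.ofReal_rpow_of_pos hd]
  · congr 1
    have h₁ : p - 1 ≠ 0 := by linarith
    have h₂ : p ≠ 0 := by linarith
    have hdp : d ^ p = d ^ (p - 1) * d := by
      rw [← Real.rpow_add_one hd.ne', sub_add_cancel]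
    rw [show p - 2 + 1 = p - 1 by ring, sub_add_cancel, Real.zero_rpow h₁, Real.zero_rpow h₂, hdp]
    field_simp
    ring
  · filter_upwards [ae_restrict_mem measurableSet_Ioc] with u hu
    have hpow : u ^ (p - 1) = u * u ^ (p - 2) := by
      rw [mul_comm, ← Real.rpow_add_one hu.1.ne']
      congr 1
      ring
    have : 0 ≤ u ^ (p - 2) := Real.rpow_nonneg hu.1.le _
    simp only [Pi.zero_apply]
    rw [hpow, ← sub_mul]
    exact mul_nonneg (mul_nonneg (by linarith) (by linarith))
      (mul_nonneg (by linarith [hu.2]) this)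

lemma lintegral_quantileCoupling_ofReal_sub_rpow_le {p : ℝ} (hp : 1 ≤ p) {P Q : Measure ℝ}
    [IsProbabilityMeasure P] [IsProbabilityMeasure Q] {γ : Measure (ℝ × ℝ)}
    (hγ : γ ∈ coupling P Q) :
    ∫⁻ z, ENNReal.ofReal (z.1 - z.2) ^ p ∂quantileCoupling P Q ≤
      ∫⁻ z, ENNReal.ofReal (z.1 - z.2) ^ p ∂γ := by
  rcases hp.eq_or_lt with rfl | hp
  · simpa using lintegral_quantileCoupling_ofReal_sub_sub_le hγ 0
  have hmix (ν : Measure (ℝ × ℝ)) [SFinite ν] :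
      ∫⁻ z, ENNReal.ofReal (z.1 - z.2) ^ p ∂ν =
        ∫⁻ u in Ioi (0 : ℝ), ENNReal.ofReal (p * (p - 1) * u ^ (p - 2)) *
          ∫⁻ z, ENNReal.ofReal (z.1 - z.2 - u) ∂ν := by
    simp_rw [ofReal_rpow_eq_lintegral hp]
    rw [lintegral_lintegral_swap (Measurable.aemeasurable (by fun_prop))]
    exact lintegral_congr fun u => lintegral_const_mul _ (by fun_prop)
  have := isProbabilityMeasure_of_mem_coupling hγ
  have := isProbabilityMeasure_of_mem_coupling (quantileCoupling_mem_coupling P Q)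
  rw [hmix, hmix]
  exact lintegral_mono fun u =>
    mul_le_mul_right (lintegral_quantileCoupling_ofReal_sub_sub_le hγ u) _

lemma edist_rpow_eq_add {p : ℝ} (hp : 0 < p) (x y : ℝ) :
    edist x y ^ p = ENNReal.ofReal (x - y) ^ p + ENNReal.ofReal (y - x) ^ p := by
  rw [edist_dist, Real.dist_eq]
  rcases le_total x y with h | h
  · rw [abs_of_nonpos (sub_nonpos.2 h), ENNReal.ofReal_of_nonpos (sub_nonpos.2 h),
      ENNReal.zero_rpow_of_pos hp, zero_add, neg_sub]
  · rw [abs_of_nonneg (sub_nonneg.2 h), ENNReal.ofReal_of_nonpos (sub_nonpos.2 h),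
      ENNReal.zero_rpow_of_pos hp, add_zero]

/-- The comonotone coupling is optimal for the cost `|x - y| ^ p`. -/
lemma lintegral_quantileCoupling_edist_rpow_le {p : ℝ} (hp : 1 ≤ p) {P Q : Measure ℝ}
    [IsProbabilityMeasure P] [IsProbabilityMeasure Q] {γ : Measure (ℝ × ℝ)}
    (hγ : γ ∈ coupling P Q) :
    ∫⁻ z, edist z.1 z.2 ^ p ∂quantileCoupling P Q ≤ ∫⁻ z, edist z.1 z.2 ^ p ∂γ := by
  have hsplit (ν : Measure (ℝ × ℝ)) : ∫⁻ z, edist z.1 z.2 ^ p ∂ν =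
      ∫⁻ z, ENNReal.ofReal (z.1 - z.2) ^ p ∂ν +
        ∫⁻ z, ENNReal.ofReal (z.1 - z.2) ^ p ∂(ν.map Prod.swap) := by
    simp_rw [edist_rpow_eq_add (zero_lt_one.trans_le hp)]
    rw [lintegral_add_left (by fun_prop), lintegral_map (by fun_prop) measurable_swap]
    rfl
  rw [hsplit, hsplit, map_swap_quantileCoupling]
  exact add_le_add (lintegral_quantileCoupling_ofReal_sub_rpow_le hp hγ)
    (lintegral_quantileCoupling_ofReal_sub_rpow_le hp (map_swap_mem_coupling hγ))

lemma memLp_quantile {p : ℝ} (hp : 0 < p) (P : Measure ℝ) [IsProbabilityMeasure P]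
    (hP : Integrable (fun x => |x| ^ p) P) :
    MemLp (quantile P) (ENNReal.ofReal p) (volume.restrict (Ioo (0 : ℝ) 1)) := by
  have hid : MemLp id (ENNReal.ofReal p) P := by
    rw [← integrable_norm_rpow_iff aestronglyMeasurable_id (by simpa using hp)
      ENNReal.ofReal_ne_top, ENNReal.toReal_ofReal hp.le]
    simpa using hP
  rw [← map_quantile P] at hid
  exact hid.comp_of_map (aemeasurable_quantile P)

lemma integrable_abs_quantile_sub_rpow {p : ℝ} (hp : 0 < p) (P Q : Measure ℝ)
    [IsProbabilityMeasure P] [IsProbabilityMeasure Q]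
    (hP : Integrable (fun x => |x| ^ p) P) (hQ : Integrable (fun x => |x| ^ p) Q) :
    IntegrableOn (fun r => |quantile P r - quantile Q r| ^ p) (Ioo (0 : ℝ) 1) := by
  have h := ((memLp_quantile hp P hP).sub (memLp_quantile hp Q hQ)).integrable_norm_rpow
    (by simpa using hp) ENNReal.ofReal_ne_top
  simpa [ENNReal.toReal_ofReal hp.le, IntegrableOn] using h

/-- For `p ≥ 1` and probability measures on `ℝ` with finite `p`-th moments,
`W_p(P,Q) = (∫_0^1 |C_P⁻¹(r) − C_Q⁻¹(r)|^p dr)^{1/p}`. -/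
theorem Wp_eq_integral_quantile (p : ℝ) (hp : 1 ≤ p) (P Q : Measure ℝ)
    [IsProbabilityMeasure P] [IsProbabilityMeasure Q]
    (hP : Integrable (fun x => |x| ^ p) P) (hQ : Integrable (fun x => |x| ^ p) Q) :
    Wp p P Q =
      ENNReal.ofReal ((∫ r in Set.Ioo (0 : ℝ) 1, |quantile P r - quantile Q r| ^ p) ^ (1 / p)) := by
  have hp0 : 0 < p := zero_lt_one.trans_le hp
  have hinf : ⨅ γ ∈ coupling P Q, ∫⁻ z, edist z.1 z.2 ^ p ∂γ =
      ∫⁻ z, edist z.1 z.2 ^ p ∂quantileCoupling P Q :=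
    le_antisymm (iInf₂_le _ (quantileCoupling_mem_coupling P Q))
      (le_iInf₂ fun _ hγ => lintegral_quantileCoupling_edist_rpow_le hp hγ)
  have hnonneg (r : ℝ) : 0 ≤ |quantile P r - quantile Q r| ^ p := by positivity
  rw [Wp, hinf, ← ENNReal.ofReal_rpow_of_nonneg (integral_nonneg hnonneg) (by positivity),
    ofReal_integral_eq_lintegral_ofReal (integrable_abs_quantile_sub_rpow hp0 P Q hP hQ)
      (.of_forall hnonneg), quantileCoupling,
    lintegral_map' (Measurable.aemeasurable (by fun_prop)) (aemeasurable_quantile_prodMk P Q)]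
  congr 1
  refine lintegral_congr fun r => ?_
  rw [edist_dist, Real.dist_eq, ENNReal.ofReal_rpow_of_nonneg (abs_nonneg _) hp0.le]
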